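/- arXiv:2001.11979 — 2 statements merged into one kernel-verified Lean document; each statement's English description precedes it below -/
import Mathlib

section
/- In the holomorph hol(A) of a left Leibniz algebra A, the left centralizer of A in hol(A) equals {x − L_x : x ∈ A}, i.e., Z^l_{hol(A)}(A) = {x − L_x : x ∈ A}. -/
section Defs
variable {F A : Type*} [Field F] [AddCommGroup A] [Module F A]

def IsLeibniz (b : A →ₗ[F] A →ₗ[F] A) : Prop :=
  ∀ x y z : A, b x (b y z) = b (b x y) z + b y (b x z)

def IsDer (b : A →ₗ[F] A →ₗ[F] A) (δ : A →ₗ[F] A) : Prop :=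
  ∀ x y : A, δ (b x y) = b (δ x) y + b x (δ y)

def Leib (b : A →ₗ[F] A →ₗ[F] A) : Submodule F A :=
  Submodule.span F {z | ∃ x : A, z = b x x}

/-- `Der(A)`: the derivations of `(A, b)`, as a submodule of `End(A)`. -/
def DerSub (b : A →ₗ[F] A →ₗ[F] A) : Submodule F (A →ₗ[F] A) where
  carrier := {δ | IsDer b δ}
  add_mem' := by
    intro f g hf hg x y
    simp only [LinearMap.add_apply, hf x y, hg x y, map_add, LinearMap.add_apply]
    abel
  zero_mem' := by intro x y; simp
  smul_mem' := by
    intro c f hf x y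
    simp only [LinearMap.smul_apply, hf x y, map_smul, smul_add, LinearMap.smul_apply]

lemma leftMul_mem_DerSub {b : A →ₗ[F] A →ₗ[F] A} (hb : IsLeibniz b) (a : A) :
    b a ∈ DerSub b :=
  fun x y => hb a x y

lemma comm_mem_DerSub {b : A →ₗ[F] A →ₗ[F] A} {f g : A →ₗ[F] A}
    (hf : f ∈ DerSub b) (hg : g ∈ DerSub b) : f ∘ₗ g - g ∘ₗ f ∈ DerSub b := by
  have hf' : ∀ x y : A, f (b x y) = b (f x) y + b x (f y) := hf
  have hg' : ∀ x y : A, g (b x y) = b (g x) y + b x (g y) := hg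
  intro x y
  simp only [LinearMap.sub_apply, LinearMap.comp_apply, hf', hg', map_add, map_sub,
    LinearMap.sub_apply, LinearMap.add_apply]
  abel

/-- The holomorph `hol(A) = A ⊕ Der(A)` with bracket
`[x+δ₁, y+δ₂] = [x,y] + δ₁(y) + [L_x, δ₂] + [δ₁, δ₂]`, where `[L_x, δ₂] = L_{-δ₂(x)}`. -/
def holB (b : A →ₗ[F] A →ₗ[F] A) (hb : IsLeibniz b) :
    A × DerSub b → A × DerSub b → A × DerSub b :=
  fun u v =>
    (b u.1 v.1 + (u.2 : A →ₗ[F] A) v.1,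
     ⟨-(b ((v.2 : A →ₗ[F] A) u.1)) +
        ((u.2 : A →ₗ[F] A) ∘ₗ (v.2 : A →ₗ[F] A) - (v.2 : A →ₗ[F] A) ∘ₗ (u.2 : A →ₗ[F] A)),
      add_mem (neg_mem (leftMul_mem_DerSub hb _)) (comm_mem_DerSub u.2.2 v.2.2)⟩)

end Defs

/-- In the holomorph `hol(A)` of a left Leibniz algebra `A`, the left centralizer of `A`
(viewed as the subspace `{(a, 0)}`) equals `{x - L_x : x ∈ A}`. -/
theorem leftCentralizer_in_holomorph {F A : Type*} [Field F] [AddCommGroup A] [Module F A]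
    (b : A →ₗ[F] A →ₗ[F] A) (hb : IsLeibniz b) :
    {u : A × DerSub b | ∀ a : A, holB b hb u (a, 0) = 0} =
      Set.range (fun x : A =>
        ((x, ⟨-(b x), neg_mem (leftMul_mem_DerSub hb x)⟩) : A × DerSub b)) := by
  ext ⟨x, d⟩
  simp only [Set.mem_setOf_eq, Set.mem_range]
  constructor
  · intro h
    refine ⟨x, Prod.ext rfl (Subtype.ext (LinearMap.ext fun a => ?_))⟩
    have h1 : b x a + (d : A →ₗ[F] A) a = 0 := congrArg Prod.fst (h a)
    exact neg_eq_of_add_eq_zero_right h1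
  · rintro ⟨y, hy⟩ a
    rw [← hy]
    refine Prod.ext ?_ (Subtype.ext ?_)
    · simp [holB]
    · simp [holB]
end

section
/- If A is a complete left Leibniz algebra, then hol(A) = A + (Z^l_{hol(A)}(A) ⊕ I) and A ∩ (Z^l_{hol(A)}(A) ⊕ I) = Leib(A), where I = {δ ∈ Der(A) : im(δ) ⊆ Leib(A)}. -/
lemma holB_zero_iff {F A : Type*} [Field F] [AddCommGroup A] [Module F A]
    (b : A →ₗ[F] A →ₗ[F] A) (hb : IsLeibniz b) (w : A × DerSub b) :
    (∀ c : A, holB b hb w (c, 0) = 0) ↔ ∀ c : A, b w.1 c + (w.2 : A →ₗ[F] A) c = 0 := by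
  refine forall_congr' fun c => ?_
  simp [holB, Prod.ext_iff]

lemma leib_left_zero {F A : Type*} [Field F] [AddCommGroup A] [Module F A]
    (b : A →ₗ[F] A →ₗ[F] A) (hb : IsLeibniz b) (x : A) (hx : x ∈ Leib b) : b x = 0 := by
  have : Leib b ≤ LinearMap.ker b := by
    refine Submodule.span_le.2 ?_
    rintro _ ⟨x, rfl⟩
    refine LinearMap.mem_ker.2 (LinearMap.ext fun z => ?_)
    have h := hb x x z
    simpa using h
  exact this hx

/-- If `A` is a complete left Leibniz algebra (`Z(A/Leib(A)) = 0` and all derivations are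
inner), then `hol(A) = A + (Z^l_{hol(A)}(A) ⊕ I)` and `A ∩ (Z^l_{hol(A)}(A) ⊕ I) = Leib(A)`,
where `I = {δ ∈ Der(A) : im(δ) ⊆ Leib(A)}`. -/
theorem holomorph_decomposition_of_complete
    {F A : Type*} [Field F] [AddCommGroup A] [Module F A]
    (b : A →ₗ[F] A →ₗ[F] A) (hb : IsLeibniz b)
    (hZ : ∀ x : A, (∀ y : A, b x y ∈ Leib b) → x ∈ Leib b)
    (hinner : ∀ δ : A →ₗ[F] A, IsDer b δ → ∃ x : A, ∀ y : A, δ y - b x y ∈ Leib b) :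
    (∀ u : A × DerSub b,
      ∃ a ∈ {w : A × DerSub b | w.2 = 0},
      ∃ z ∈ {w : A × DerSub b | ∀ c : A, holB b hb w (c, 0) = 0},
      ∃ i ∈ {w : A × DerSub b | w.1 = 0 ∧ ∀ y : A, (w.2 : A →ₗ[F] A) y ∈ Leib b},
        u = a + z + i) ∧
    ({w : A × DerSub b | ∀ c : A, holB b hb w (c, 0) = 0} ∩
      {w : A × DerSub b | w.1 = 0 ∧ ∀ y : A, (w.2 : A →ₗ[F] A) y ∈ Leib b} ⊆ {0}) ∧
    ({w : A × DerSub b | w.2 = 0} ∩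
      {w : A × DerSub b |
        ∃ z ∈ {w : A × DerSub b | ∀ c : A, holB b hb w (c, 0) = 0},
        ∃ i ∈ {w : A × DerSub b | w.1 = 0 ∧ ∀ y : A, (w.2 : A →ₗ[F] A) y ∈ Leib b},
          w = z + i} =
      {w : A × DerSub b | w.2 = 0 ∧ w.1 ∈ Leib b}) := by
  simp only [holB_zero_iff]
  refine ⟨?_, ?_, ?_⟩
  · rintro ⟨a, δ, hδ⟩
    obtain ⟨x, hx⟩ := hinner δ hδ
    refine ⟨(a + x, 0), rfl, (-x, ⟨b x, leftMul_mem_DerSub hb x⟩), ?_,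
      (0, ⟨δ, hδ⟩ - ⟨b x, leftMul_mem_DerSub hb x⟩), ⟨rfl, ?_⟩, ?_⟩
    · intro c
      simp
    · intro y
      simpa using hx y
    · ext <;> simp
  · rintro ⟨a, δ, hδ⟩ ⟨h1, h2, -⟩
    simp only at h2
    subst h2
    have : δ = 0 := LinearMap.ext fun c => by simpa using h1 c
    subst this
    rfl
  · ext w
    constructor
    · rintro ⟨h0, z, hz, i, ⟨hi, hi'⟩, rfl⟩
      refine ⟨h0, ?_⟩
      have h0' : z.2 + i.2 = 0 := h0
      have e : (z + i).1 = z.1 := by simp [hi]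
      rw [e]
      refine hZ _ fun y => ?_
      have h3 := hz y
      rw [eq_neg_of_add_eq_zero_left h0'] at h3
      have h4 : b z.1 y = (i.2 : A →ₗ[F] A) y := by
        simpa [add_neg_eq_zero] using h3
      rw [h4]
      exact hi' y
    · rintro ⟨h0, h1⟩
      refine ⟨h0, w, ?_, 0, ⟨rfl, fun y => by simp⟩, by simp⟩
      intro c
      have h0' : w.2 = 0 := h0
      simp [leib_left_zero b hb _ h1, h0']
end
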